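/- arXiv:1501.04182 — 2 statements merged into one kernel-verified Lean document; each statement's English description precedes it below -/
import Mathlib

section
/- Let G be a countable group that is highly transitive, i.e., G admits a faithful action on a countably infinite set that is k-transitive for every k ∈ ℕ. Then exactly one of the following two mutually exclusive conditions holds: (a) G contains a normal subgroup isomorphic to Alt(ℕ); (b) G is mixed identity free (MIF). -/
/-- The infinite alternating group `Alt(ℕ)`: the subgroup of `Equiv.Perm ℕ` generated by all
3-cycles (equivalently, the group of finitary even permutations of `ℕ`). -/
def AltN : Subgroup (Equiv.Perm ℕ) :=
  Subgroup.closure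
    {σ | ∃ x y z : ℕ, x ≠ y ∧ y ≠ z ∧ x ≠ z ∧ σ = Equiv.swap x y * Equiv.swap y z}

/-- `w ∈ G * F_n` is a mixed identity of `G`: every substitution of elements of `G` for the
free generators (via the homomorphism `G * F_n → G` that is the identity on `G`) kills `w`. -/
def SatisfiesMixedIdentity (G : Type*) [Group G] {n : ℕ}
    (w : Monoid.Coprod G (FreeGroup (Fin n))) : Prop :=
  ∀ g : Fin n → G, Monoid.Coprod.lift (MonoidHom.id G) (FreeGroup.lift g) w = 1

/-- A group is mixed identity free (MIF) if it satisfies no nontrivial mixed identity. -/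
def IsMIF (G : Type*) [Group G] : Prop :=
  ∀ (n : ℕ) (w : Monoid.Coprod G (FreeGroup (Fin n))), SatisfiesMixedIdentity G w → w = 1

/-- `G` is highly transitive: it admits a faithful action on a countably infinite set that is
`k`-transitive for every `k`. -/
def IsHighlyTransitive (G : Type*) [Group G] : Prop :=
  ∃ (Ω : Type) (_ : Countable Ω) (_ : Infinite Ω) (ρ : G →* Equiv.Perm Ω),
    Function.Injective ρ ∧
      ∀ (k : ℕ) (a b : Fin k → Ω), Function.Injective a → Function.Injective b →
        ∃ g : G, ∀ i, ρ g (a i) = b i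

namespace HTD

variable {G : Type*} [Group G] {ι : Type*}

def R (a b : ι × Bool × G) : Prop := a.2.2 = 1 → a.1 = b.1 → a.2.1 = b.2.1

/-- signed power -/
def sp {H : Type*} [Group H] (x : H) : Bool → H
  | true => x
  | false => x⁻¹

theorem sp_mul_not {H : Type*} [Group H] (x : H) (e : Bool) : sp x e * sp x (!e) = 1 := by
  cases e <;> simp [sp]

theorem map_sp {H K : Type*} [Group H] [Group K] (f : H →* K) (x : H) (e : Bool) :
    f (sp x e) = sp (f x) e := by
  cases e <;> simp [sp]

/-- value of a word -/
def val {H : Type*} [Group H] (f : G →* H) (x : ι → H) (L : List (ι × Bool × G)) : H :=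
  (L.map fun t => sp (x t.1) t.2.1 * f t.2.2).prod

theorem map_val {H K : Type*} [Group H] [Group K] (f : G →* H) (x : ι → H) (φ : H →* K)
    (L : List (ι × Bool × G)) :
    φ (val f x L) = val (φ.comp f) (fun i => φ (x i)) L := by
  simp [val, map_list_prod, Function.comp_def, map_sp]

theorem exists_word (w : Monoid.Coprod G (FreeGroup ι)) :
    ∃ (h : G) (L : List (ι × Bool × G)), L.IsChain R ∧
      w = Monoid.Coprod.inl h *
        val Monoid.Coprod.inl (fun i => Monoid.Coprod.inr (FreeGroup.of i)) L := by
  have step : ∀ (i : ι) (e : Bool) (h : G) (L : List (ι × Bool × G)), L.IsChain R →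
      ∃ (h' : G) (L' : List (ι × Bool × G)), L'.IsChain R ∧
      sp (Monoid.Coprod.inr (FreeGroup.of i)) e * (Monoid.Coprod.inl h *
        val Monoid.Coprod.inl (fun i => Monoid.Coprod.inr (FreeGroup.of i)) L) =
      (Monoid.Coprod.inl h' *
        val Monoid.Coprod.inl (fun i => Monoid.Coprod.inr (FreeGroup.of i)) L'
        : Monoid.Coprod G (FreeGroup ι)) := by
    intro i e h L hL
    by_cases hc : ((i, e, h) :: L).IsChain R
    · refine ⟨1, _, hc, ?_⟩
      simp [val, mul_assoc]
    · cases L with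
      | nil => simp at hc
      | cons t L =>
        obtain ⟨j, e', k⟩ := t
        rw [List.isChain_cons_cons] at hc
        have hn : ¬ R (i, e, h) (j, e', k) := fun h' => hc ⟨h', hL⟩
        simp only [R, Classical.not_imp] at hn
        obtain ⟨rfl, rfl, he⟩ := hn
        have he' : e' = !e := by cases e <;> cases e' <;> simp_all
        subst he'
        refine ⟨k, L, ?_, ?_⟩
        · exact (List.isChain_cons.1 hL).2
        · simp only [val, List.map_cons, List.prod_cons, map_one, one_mul]
          rw [← mul_assoc, ← mul_assoc, sp_mul_not, one_mul]
  induction w using Monoid.Coprod.induction_on' with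
  | one => exact ⟨1, [], by simp, by simp [val]⟩
  | inl_mul g x ih =>
    obtain ⟨h, L, hL, rfl⟩ := ih
    exact ⟨g * h, L, hL, by simp [mul_assoc]⟩
  | inr_mul u x ih =>
    induction u using FreeGroup.induction_on generalizing x with
    | C1 => simpa using ih
    | of i =>
      obtain ⟨h, L, hL, rfl⟩ := ih
      exact step i true h L hL
    | inv_of i _ =>
      obtain ⟨h, L, hL, rfl⟩ := ih
      have := step i false h L hL
      simpa [sp] using this
    | mul a b iha ihb =>
      rw [map_mul, mul_assoc]
      exact iha _ (ihb _ ih)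

/-- Main trajectory construction. -/
theorem trajectory {Ω : Type*} [Infinite Ω] (ρ : G →* Equiv.Perm Ω)
    (hinf : ∀ g : G, g ≠ 1 → {a | ρ g a ≠ a}.Infinite) (L : List (ι × Bool × G)) :
    L.IsChain R → ∀ h : G,
    ∃ (p q : Ω) (C : Set (ι × Bool × Ω × Ω)), C.Finite ∧
      (∀ i e a b b', (i, e, a, b) ∈ C → (i, e, a, b') ∈ C → b = b') ∧
      (∀ i e a b, (i, e, a, b) ∈ C → (i, !e, b, a) ∈ C) ∧
      (∀ x : ι → Equiv.Perm Ω, (∀ i e a b, (i, e, a, b) ∈ C → sp (x i) e a = b) →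
        (ρ h * val ρ x L) p = q) ∧
      (L ≠ [] → q ≠ p) ∧
      (∀ i e b, ((i, e, h) :: L).IsChain R → (i, e, q, b) ∉ C) := by
  induction L with
  | nil =>
    intro _ h
    obtain ⟨p⟩ : Nonempty Ω := inferInstance
    exact ⟨p, ρ h p, ∅, by simp [val]⟩
  | cons t L ih =>
    obtain ⟨i, e, k⟩ := t
    intro hL h
    obtain ⟨p, q, C, hfin, hfun, hsym, hx, -, hI⟩ := ih (List.isChain_cons.1 hL).2 k
    -- the finite set to avoid
    set F : Set Ω := (fun c => c.2.2.1) '' C ∪ {p, q} with hF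
    have hFfin : F.Finite := (hfin.image _).union (by simp)
    obtain ⟨r, hr1, hr2, hr3⟩ : ∃ r, r ∉ F ∧ ρ h r ∉ F ∧ (h ≠ 1 → ρ h r ≠ r) := by
      have hbad : (F ∪ (ρ h) ⁻¹' F).Finite :=
        hFfin.union (hFfin.preimage (ρ h).injective.injOn)
      by_cases hh : h = 1
      · obtain ⟨r, hr⟩ := hbad.infinite_compl.nonempty
        simp only [Set.mem_compl_iff, Set.mem_union, not_or] at hr
        exact ⟨r, hr.1, hr.2, fun h' => absurd hh h'⟩
      · obtain ⟨r, hr, hr'⟩ := ((hinf h hh).sdiff hbad).nonempty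
        simp only [Set.mem_union, not_or] at hr'
        exact ⟨r, hr'.1, hr'.2, fun _ => hr⟩
    have key : ∀ z, z ∉ F → ∀ i e b, (i, e, z, b) ∉ C := fun z hz i e b hc =>
      hz (Or.inl ⟨_, hc, rfl⟩)
    have hrq : r ≠ q := fun h' => hr1 (by simp [hF, h'])
    have hq : ρ h r ≠ q := fun h' => hr2 (by simp [hF, h'])
    have hp : ρ h r ≠ p := fun h' => hr2 (by simp [hF, h'])
    have hnew : ∀ b, (i, e, q, b) ∉ C := fun b => hI i e b hL
    refine ⟨p, ρ h r, insert (i, e, q, r) (insert (i, !e, r, q) C), ?_, ?_, ?_, ?_, ?_, ?_⟩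
    · exact (hfin.insert _).insert _
    · intro i' e' a b b' h1 h2
      simp only [Set.mem_insert_iff, Prod.mk.injEq] at h1 h2
      rcases h1 with ⟨rfl, rfl, rfl, rfl⟩ | ⟨rfl, rfl, rfl, rfl⟩ | h1 <;>
      rcases h2 with ⟨h21, h22, h23, h24⟩ | ⟨h21, h22, h23, h24⟩ | h2
      · exact h24.symm
      · exact absurd h23.symm hrq
      · exact absurd h2 (hnew _)
      · exact absurd h23 hrq
      · exact h24.symm
      · exact absurd h2 (key _ hr1 _ _ _)
      · subst h21 h22 h23
        exact absurd h1 (hnew _)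
      · subst h23
        exact absurd h1 (key _ hr1 _ _ _)
      · exact hfun _ _ _ _ _ h1 h2
    · intro i' e' a b h1
      simp only [Set.mem_insert_iff, Prod.mk.injEq] at h1 ⊢
      rcases h1 with ⟨rfl, rfl, rfl, rfl⟩ | ⟨rfl, rfl, rfl, rfl⟩ | h1
      · simp
      · simp
      · exact Or.inr (Or.inr (hsym _ _ _ _ h1))
    · intro x hC
      have h1 := hx x fun i e a b hc => hC i e a b (by simp [hc])
      have h2 := hC i e q r (by simp)
      have : val ρ x ((i, e, k) :: L) = sp (x i) e * (ρ k * val ρ x L) := by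
        simp [val, mul_assoc]
      rw [this, Equiv.Perm.mul_apply, Equiv.Perm.mul_apply, h1, h2]
    · exact fun _ => hp
    · intro i' e' b hch h1
      simp only [Set.mem_insert_iff, Prod.mk.injEq] at h1
      rcases h1 with ⟨-, -, h1, -⟩ | ⟨h11, h12, h13, -⟩ | h1
      · exact hq h1
      · have hh : h = 1 := by
          by_contra hh
          exact hr3 hh h13
        have := (List.isChain_cons_cons.1 hch).1 hh h11
        simp only at this
        rw [h12] at this
        cases e <;> simp at this
      · exact key _ hr2 _ _ _ h1

theorem realize {Ω H : Type*} [Group H] (τ : H →* Equiv.Perm Ω)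
    (ht : ∀ (k : ℕ) (a b : Fin k → Ω), Function.Injective a → Function.Injective b →
        ∃ g : H, ∀ i, τ g (a i) = b i)
    (C : Set (ι × Bool × Ω × Ω)) (hfin : C.Finite)
    (hfun : ∀ i e a b b', (i, e, a, b) ∈ C → (i, e, a, b') ∈ C → b = b')
    (hsym : ∀ i e a b, (i, e, a, b) ∈ C → (i, !e, b, a) ∈ C) :
    ∃ x : ι → H, ∀ i e a b, (i, e, a, b) ∈ C → sp (τ (x i)) e a = b := by
  have : ∀ i, ∃ g : H, ∀ a b, (i, true, a, b) ∈ C → τ g a = b := by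
    intro i
    let D : Set (Ω × Ω) := {c | (i, true, c.1, c.2) ∈ C}
    have hD : D.Finite := by
      refine hfin.preimage (f := fun c : Ω × Ω => (i, true, c.1, c.2)) ?_
      rintro ⟨a, b⟩ - ⟨c, d⟩ - h
      simpa using h
    have : Finite D := hD
    obtain ⟨k, ⟨E⟩⟩ := Finite.exists_equiv_fin D
    obtain ⟨g, hg⟩ := ht k (fun j => (E.symm j).1.1) (fun j => (E.symm j).1.2)
      (by
        intro j j' h
        apply E.symm.injective
        apply Subtype.ext
        have h1 := (E.symm j).2
        have h2 := (E.symm j').2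
        refine Prod.ext h ?_
        simp only at h
        refine hfun i true _ _ _ h1 ?_
        rw [h]; exact h2)
      (by
        intro j j' h
        apply E.symm.injective
        apply Subtype.ext
        have h1 := hsym _ _ _ _ (E.symm j).2
        have h2 := hsym _ _ _ _ (E.symm j').2
        refine Prod.ext ?_ h
        simp only at h
        refine hfun i (!true) _ _ _ h1 ?_
        rw [h]; exact h2)
    refine ⟨g, fun a b hab => ?_⟩
    have := hg (E ⟨(a, b), hab⟩)
    simpa using this
  choose x hx using this
  refine ⟨x, fun i e a b h => ?_⟩
  cases e with
  | true => exact hx i a b h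
  | false =>
    have := hx i b a (hsym _ _ _ _ h)
    simp [sp, ← this]

/-- A nonempty reduced word acts nontrivially for some substitution. -/
theorem exists_ne {Ω H : Type*} [Infinite Ω] [Group H] (ρ : G →* Equiv.Perm Ω)
    (hinf : ∀ g : G, g ≠ 1 → {a | ρ g a ≠ a}.Infinite)
    (τ : H →* Equiv.Perm Ω)
    (ht : ∀ (k : ℕ) (a b : Fin k → Ω), Function.Injective a → Function.Injective b →
        ∃ g : H, ∀ i, τ g (a i) = b i)
    (L : List (ι × Bool × G)) (hL : L.IsChain R) (hne : L ≠ []) (h : G) :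
    ∃ x : ι → H, ρ h * val ρ (fun i => τ (x i)) L ≠ 1 := by
  obtain ⟨p, q, C, hfin, hfun, hsym, hx, hpq, -⟩ := trajectory ρ hinf L hL h
  obtain ⟨x, hx'⟩ := realize τ ht C hfin hfun hsym
  refine ⟨x, fun h1 => hpq hne ?_⟩
  rw [← hx _ hx', h1]; rfl

theorem mif_of_infinite_support {Ω : Type*} [Infinite Ω] (ρ : G →* Equiv.Perm Ω)
    (hinf : ∀ g : G, g ≠ 1 → {a | ρ g a ≠ a}.Infinite)
    (ht : ∀ (k : ℕ) (a b : Fin k → Ω), Function.Injective a → Function.Injective b →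
        ∃ g : G, ∀ i, ρ g (a i) = b i) : IsMIF G := by
  intro n w hw
  obtain ⟨h, L, hL, rfl⟩ := exists_word w
  by_cases hne : L = []
  · subst hne
    have := hw (fun _ => 1)
    simp [val] at this
    simp [this, val]
  · exfalso
    obtain ⟨x, hx⟩ := exists_ne ρ hinf ρ ht L hL hne h
    apply hx
    have := congrArg ρ (hw x)
    rw [map_mul, map_val, map_mul, map_val, map_one] at this
    simp only [Monoid.Coprod.lift_apply_inl, Monoid.Coprod.lift_apply_inr, FreeGroup.lift_apply_of,
      MonoidHom.id_apply] at this
    have e1 : (ρ.comp ((Monoid.Coprod.lift (MonoidHom.id G) (FreeGroup.lift x)).comp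
      Monoid.Coprod.inl)) = ρ := by ext; simp
    rw [e1] at this
    exact this

theorem perm_ht {Ω : Type*} (k : ℕ) (a b : Fin k → Ω) (ha : Function.Injective a)
    (hb : Function.Injective b) : ∃ g : Equiv.Perm Ω, ∀ i, g (a i) = b i := by
  have := (MulAction.isMultiplyPretransitive_iff (n := k)).1
    (Equiv.Perm.isMultiplyPretransitive Ω k) ⟨a, ha⟩ ⟨b, hb⟩
  obtain ⟨g, hg⟩ := this
  exact ⟨g, fun i => by simpa using DFunLike.congr_fun hg i⟩

theorem word_ne_one (L : List (ι × Bool × G)) (hL : L.IsChain R) (hne : L ≠ []) :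
    val Monoid.Coprod.inl (fun i => Monoid.Coprod.inr (FreeGroup.of i)) L ≠
      (1 : Monoid.Coprod G (FreeGroup ι)) := by
  intro h1
  let ρ : G →* Equiv.Perm (G × ℕ) :=
    { toFun := fun g => (Equiv.mulLeft g).prodCongr (Equiv.refl ℕ)
      map_one' := by ext <;> simp
      map_mul' := by intro a b; ext <;> simp [mul_assoc] }
  have hρ : ∀ g a, ρ g a = (g * a.1, a.2) := fun g a => rfl
  obtain ⟨x, hx⟩ := exists_ne ρ (by
    intro g hg
    have : {a | ρ g a ≠ a} = Set.univ := by
      ext ⟨a, m⟩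
      simp [hρ, hg]
    rw [this]; exact Set.infinite_univ) (MonoidHom.id _) perm_ht L hL hne 1
  apply hx
  have := congrArg (Monoid.Coprod.lift ρ (FreeGroup.lift x)) h1
  rw [map_val, map_one] at this
  simp only [Monoid.Coprod.lift_apply_inr, FreeGroup.lift_apply_of] at this
  rw [map_one, one_mul]
  rw [Monoid.Coprod.lift_comp_inl] at this
  exact this

theorem val_append {H : Type*} [Group H] (f : G →* H) (x : ι → H) (L M : List (ι × Bool × G)) :
    val f x (L ++ M) = val f x L * val f x M := by
  simp [val]

theorem val_replicate {H : Type*} [Group H] (f : G →* H) (x : ι → H) (L : List (ι × Bool × G))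
    (k : ℕ) : val f x (List.replicate k L).flatten = val f x L ^ k := by
  induction k with
  | zero => simp [val]
  | succ k ih => rw [List.replicate_succ, List.flatten_cons, val_append, ih, pow_succ']

theorem isChain_of_ne (L : List (ι × Bool × G)) (h : ∀ t ∈ L, t.2.2 ≠ 1) : L.IsChain R := by
  induction L with
  | nil => simp
  | cons t L ih =>
    rw [List.isChain_cons]
    refine ⟨fun y _ h1 => absurd h1 (h t (by simp)), ih fun t ht => h t (by simp [ht])⟩

/-- finite support gives bounded order -/
theorem pow_eq_one {Ω : Type*} [DecidableEq Ω] (τ : Equiv.Perm Ω) (T : Finset Ω)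
    (hT : ∀ x, x ∉ T → τ x = x) (k : ℕ) (hk : T.card ≤ k) : τ ^ k.factorial = 1 := by
  have h2 : ∀ x, τ x ≠ x → x ∈ T := fun x hx => by
    by_contra h
    exact hx (hT x h)
  have h1 : ∀ x, τ x ∈ T ↔ x ∈ T := by
    intro x
    by_cases hx : τ x = x
    · rw [hx]
    · exact iff_of_true (h2 _ fun h => hx (τ.injective h)) (h2 _ hx)
  rw [← Equiv.Perm.ofSubtype_subtypePerm h1 h2, ← map_pow]
  have : (τ.subtypePerm h1) ^ k.factorial = 1 := by
    have hc : Fintype.card (Equiv.Perm {x // x ∈ T}) = T.card.factorial := by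
      rw [Fintype.card_perm]; simp
    obtain ⟨m, hm⟩ := Nat.factorial_dvd_factorial hk
    rw [hm, pow_mul, ← hc, pow_card_eq_one, one_pow]
  rw [this, map_one]

theorem not_mif (N : Subgroup G) (hN : N.Normal) (φ : N ≃* AltN) : ¬ IsMIF G := by
  intro hM
  let a : Equiv.Perm ℕ := Equiv.swap 0 1 * Equiv.swap 1 2
  have ha : a ∈ AltN := Subgroup.subset_closure ⟨0, 1, 2, by simp, by simp, by simp, rfl⟩
  have ha1 : a ≠ 1 := by
    intro h
    have := congrArg (fun f : Equiv.Perm ℕ => f 2) h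
    simp [a] at this
  have hfix : ∀ x, x ∉ ({0, 1, 2} : Finset ℕ) → a x = x := by
    intro x hx
    simp only [Finset.mem_insert, Finset.mem_singleton, not_or] at hx
    simp [a, Equiv.swap_apply_of_ne_of_ne, hx.1, hx.2.1, hx.2.2]
  have hord : ∀ σ : Equiv.Perm ℕ, (σ * a * σ⁻¹ * a) ^ Nat.factorial 6 = 1 := by
    intro σ
    refine pow_eq_one _ ({0, 1, 2} ∪ ({0, 1, 2} : Finset ℕ).map σ.toEmbedding) ?_ 6 ?_
    · intro x hx
      rw [Finset.mem_union, not_or] at hx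
      have h2 : σ⁻¹ x ∉ ({0, 1, 2} : Finset ℕ) := by
        intro h
        exact hx.2 (Finset.mem_map.2 ⟨_, h, by simp⟩)
      simp only [Equiv.Perm.mul_apply]
      rw [hfix x hx.1, hfix _ h2]
      simp
    · refine (Finset.card_union_le _ _).trans ?_
      rw [Finset.card_map]; rfl
  let n0 : N := φ.symm ⟨a, ha⟩
  have hφ : φ n0 = ⟨a, ha⟩ := by simp [n0]
  have hn0 : (n0 : G) ≠ 1 := by
    intro h
    have h' : n0 = 1 := Subtype.ext h
    rw [h', map_one] at hφ
    exact ha1 (congrArg Subtype.val hφ).symm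
  let L : List (Fin 1 × Bool × G) := [(0, true, n0), (0, false, n0), (0, true, (n0 : G)⁻¹),
    (0, false, n0)]
  let LL := (List.replicate (Nat.factorial 6) L).flatten
  have hLL : LL.IsChain R := by
    apply isChain_of_ne
    intro t ht
    obtain ⟨l, hl, htl⟩ := List.mem_flatten.1 ht
    rw [(List.mem_replicate.1 hl).2] at htl
    simp only [L, List.mem_cons, List.not_mem_nil, or_false] at htl
    rcases htl with rfl | rfl | rfl | rfl <;> simp [hn0]
  have hne : LL ≠ [] := by
    intro h
    have := List.flatten_eq_nil_iff.1 h L (List.mem_replicate.2 ⟨Nat.factorial_ne_zero 6, rfl⟩)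
    simp [L] at this
  refine word_ne_one LL hLL hne (hM 1 _ ?_)
  intro g
  rw [val_replicate, map_pow, map_val]
  set y := g 0 with hy
  have hmem : y * n0 * y⁻¹ ∈ N := hN.conj_mem _ n0.2 _
  let m : N := ⟨y * n0 * y⁻¹, hmem⟩
  have key : (m * n0 * m⁻¹ * n0) ^ Nat.factorial 6 = 1 := by
    apply φ.injective
    apply Subtype.ext
    have := hord (φ m)
    simpa [hφ] using this
  have key2 := congrArg Subtype.val key
  have e : val ((Monoid.Coprod.lift (MonoidHom.id G) (FreeGroup.lift g)).comp Monoid.Coprod.inl)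
      (fun i => (Monoid.Coprod.lift (MonoidHom.id G) (FreeGroup.lift g))
        (Monoid.Coprod.inr (FreeGroup.of i))) L = ((m * n0 * m⁻¹ * n0 : N) : G) := by
    simp only [val, L, List.map_cons, List.map_nil, List.prod_cons, List.prod_nil, sp,
      Monoid.Coprod.lift_apply_inr, FreeGroup.lift_apply_of, MonoidHom.comp_apply,
      Monoid.Coprod.lift_apply_inl, MonoidHom.id_apply, m, ← hy, Subgroup.coe_mul,
      Subgroup.coe_inv]
    group
  rw [e]
  exact_mod_cast key2

theorem swap_conj {Ω : Type*} [DecidableEq Ω] (σ : Equiv.Perm Ω) (x y : Ω) :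
    σ * Equiv.swap x y * σ⁻¹ = Equiv.swap (σ x) (σ y) := by
  rw [Equiv.swap_apply_apply]

theorem three_conj (σ : Equiv.Perm ℕ) (x y z : ℕ) :
    σ * (Equiv.swap x y * Equiv.swap y z) * σ⁻¹ =
      Equiv.swap (σ x) (σ y) * Equiv.swap (σ y) (σ z) := by
  rw [← swap_conj, ← swap_conj]; group

theorem altN_normal : AltN.Normal := by
  refine ⟨fun n hn σ => ?_⟩
  have hle : AltN ≤ AltN.comap (MulAut.conj σ).toMonoidHom := by
    conv_lhs => unfold AltN
    rw [Subgroup.closure_le]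
    rintro τ ⟨x, y, z, hxy, hyz, hxz, rfl⟩
    refine Subgroup.subset_closure ⟨σ x, σ y, σ z, ?_, ?_, ?_, three_conj σ x y z⟩
    · exact σ.injective.ne hxy
    · exact σ.injective.ne hyz
    · exact σ.injective.ne hxz
  exact hle hn

theorem inj_three (x y z : ℕ) (hxy : x ≠ y) (hyz : y ≠ z) (hxz : x ≠ z) :
    Function.Injective ![x, y, z] := by
  intro i j h
  fin_cases i <;> fin_cases j <;> simp at h ⊢ <;> omega

/-- commutator of permutations whose supports meet in one point -/
theorem comm_three (g h : Equiv.Perm ℕ) (a : ℕ) (hga : g a ≠ a) (hha : h a ≠ a)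
    (hd : ∀ x, x ≠ a → g x = x ∨ h x = x) :
    g * h * g⁻¹ * h⁻¹ = Equiv.swap a (g a) * Equiv.swap (g a) (h a) ∧ g a ≠ h a := by
  have hne : g a ≠ h a := by
    intro e
    rcases hd (g a) hga with h1 | h1
    · exact hga (g.injective h1)
    · rw [e] at h1; exact hha (h.injective h1)
  refine ⟨?_, hne⟩
  have A : ∀ x, g (g⁻¹ x) = x := fun x => by simp
  have B : ∀ x, h (h⁻¹ x) = x := fun x => by simp
  have hgi : ∀ x, g x = x → g⁻¹ x = x := fun x e => g.injective (by rw [A, e])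
  have hhi : ∀ x, h x = x → h⁻¹ x = x := fun x e => h.injective (by rw [B, e])
  have g1 : g (h a) = h a := (hd _ hha).resolve_right fun e => hha (h.injective e)
  have h1 : h (g a) = g a := (hd _ hga).resolve_left fun e => hga (g.injective e)
  have h2 : h (g⁻¹ a) = g⁻¹ a := (hd _ (fun e => hga (by rw [← e, A, e]))).resolve_left
    fun e => hga (by rw [A] at e; exact (congrArg g e).trans (A a))
  have g2 : g (h⁻¹ a) = h⁻¹ a := (hd _ (fun e => hha (by rw [← e, B, e]))).resolve_right
    fun e => hha (by rw [B] at e; exact (congrArg h e).trans (B a))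
  ext x
  simp only [Equiv.Perm.mul_apply]
  by_cases x1 : x = a
  · subst x1
    rw [hgi _ g2, B, Equiv.swap_apply_of_ne_of_ne hga.symm hha.symm, Equiv.swap_apply_left]
  by_cases x2 : x = g a
  · subst x2
    rw [hhi _ h1, Equiv.swap_apply_left, Equiv.swap_apply_of_ne_of_ne hha hne.symm]
    simp [g1]
  by_cases x3 : x = h a
  · subst x3
    rw [Equiv.swap_apply_right, Equiv.swap_apply_right]
    have : h⁻¹ (h a) = a := by simp
    rw [this, h2, A]
  rw [Equiv.swap_apply_of_ne_of_ne x2 x3, Equiv.swap_apply_of_ne_of_ne x1 x2]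
  rcases hd x x1 with e | e
  · have : h⁻¹ x ≠ a := fun e' => x3 (by rw [← e', B])
    rcases hd _ this with e2 | e2
    · rw [hgi _ e2, B, e]
    · rw [B] at e2
      rw [← e2, hgi _ e]
      have : h x = x := by rw [e2, B, ← e2]
      rw [this, e]
  · rw [hhi _ e]
    have : g⁻¹ x ≠ a := fun e' => x2 (by rw [← e', A])
    rcases hd _ this with e2 | e2
    · rw [A] at e2
      rw [← e2, e, e2, A, ← e2]
    · rw [e2, A]

theorem alt_of_finite_support (ρ : G →* Equiv.Perm ℕ) (hinj : Function.Injective ρ)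
    (ht : ∀ (k : ℕ) (a b : Fin k → ℕ), Function.Injective a → Function.Injective b →
        ∃ g : G, ∀ i, ρ g (a i) = b i)
    (g : G) (hg : g ≠ 1) (hfin : {a | ρ g a ≠ a}.Finite) :
    ∃ N : Subgroup G, N.Normal ∧ Nonempty (N ≃* AltN) := by
  have hle : AltN ≤ ρ.range := by
    obtain ⟨a, ha⟩ : ∃ a, ρ g a ≠ a := by
      by_contra hcon
      push Not at hcon
      exact hg (hinj (by rw [map_one]; ext x; simp [hcon x]))
    -- find k
    obtain ⟨k, hk1, hk2⟩ : ∃ k : G, ρ k a = a ∧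
        ∀ x, x ≠ a → ρ g x ≠ x → ρ g (ρ k x) = ρ k x := by
      have : Finite {a | ρ g a ≠ a} := hfin
      obtain ⟨n, ⟨E⟩⟩ := Finite.exists_equiv_fin {a | ρ g a ≠ a}
      obtain ⟨M, hM⟩ := hfin.bddAbove
      have hM' : ∀ x, ρ g x ≠ x → x ≤ M := fun x hx => hM hx
      obtain ⟨k, hk⟩ := ht n (fun j => (E.symm j).1)
        (fun j => if (E.symm j).1 = a then a else M + 1 + (E.symm j).1)
        (fun j j' h => E.symm.injective (Subtype.ext h))
        (by
          intro j j' h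
          apply E.symm.injective
          apply Subtype.ext
          have := hM' a ha
          simp only at h
          split_ifs at h with h1 h2 h2
          · rw [h1, h2]
          · omega
          · omega
          · omega)
      refine ⟨k, ?_, ?_⟩
      · have := hk (E ⟨a, ha⟩)
        simpa using this
      · intro x hx hx'
        have h1 := hk (E ⟨x, hx'⟩)
        simp only [Equiv.symm_apply_apply, hx, if_false] at h1
        rw [h1]
        by_contra hcon
        have := hM' _ hcon
        omega
    have hki : (ρ k)⁻¹ a = a := by
      apply (ρ k).injective; simp [hk1]
    obtain ⟨hc, hne⟩ := comm_three (ρ g) (ρ (k * g * k⁻¹)) a ha (by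
      simp only [map_mul, map_inv, Equiv.Perm.mul_apply, hki]
      intro e
      exact ha ((ρ k).injective (by rw [e, hk1]))) (by
      intro x hx
      by_contra hcon
      push Not at hcon
      obtain ⟨c1, c2⟩ := hcon
      simp only [map_mul, map_inv, Equiv.Perm.mul_apply] at c2
      have hkk : ρ k ((ρ k)⁻¹ x) = x := by simp
      have := hk2 ((ρ k)⁻¹ x) (fun e => hx (by rw [← hkk, e, hk1]))
        (fun e => c2 (by rw [e, hkk]))
      rw [hkk] at this
      exact c1 this)
    have hha : ρ (k * g * k⁻¹) a ≠ a := by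
      simp only [map_mul, map_inv, Equiv.Perm.mul_apply, hki]
      intro e
      exact ha ((ρ k).injective (by rw [e, hk1]))
    unfold AltN
    rw [Subgroup.closure_le]
    rintro σ ⟨x, y, z, hxy, hyz, hxz, rfl⟩
    obtain ⟨t, htt⟩ := ht 3 ![a, ρ g a, ρ (k * g * k⁻¹) a] ![x, y, z]
      (inj_three _ _ _ ha.symm hne hha.symm) (inj_three _ _ _ hxy hyz hxz)
    have t0 := htt 0
    have t1 := htt 1
    have t2 := htt 2
    simp only [Matrix.cons_val] at t0 t1 t2
    refine ⟨t * (g * (k * g * k⁻¹) * g⁻¹ * (k * g * k⁻¹)⁻¹) * t⁻¹, ?_⟩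
    rw [map_mul, map_mul, map_inv, map_mul, map_mul, map_mul, map_inv, map_inv, hc, three_conj,
      t0, t1, t2]
  have := altN_normal
  refine ⟨AltN.comap ρ, inferInstance, ⟨?_⟩⟩
  refine MulEquiv.ofBijective (ρ.subgroupComap AltN) ⟨?_, ?_⟩
  · intro a b h
    exact Subtype.ext (hinj (congrArg Subtype.val h))
  · rintro ⟨σ, hσ⟩
    obtain ⟨g, rfl⟩ := hle hσ
    exact ⟨⟨g, hσ⟩, rfl⟩

end HTD

/-- **Dichotomy for highly transitive countable groups.** If a countable group `G` is highly
transitive, then exactly one of the following holds: (a) `G` contains a normal subgroup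
isomorphic to `Alt(ℕ)`; (b) `G` is mixed identity free. -/
theorem highly_transitive_dichotomy (G : Type*) [Group G] [Countable G]
    (hht : IsHighlyTransitive G) :
    Xor' (∃ N : Subgroup G, N.Normal ∧ Nonempty (N ≃* AltN)) (IsMIF G) := by
  obtain ⟨Ω, _, _, ρ₀, hinj₀, ht₀⟩ := hht
  obtain ⟨E⟩ : Nonempty (Ω ≃ ℕ) := nonempty_equiv_of_countable
  let ρ : G →* Equiv.Perm ℕ := E.permCongrHom.toMonoidHom.comp ρ₀
  have hρ : ∀ g x, ρ g x = E (ρ₀ g (E.symm x)) := fun g x => rfl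
  have hinj : Function.Injective ρ := E.permCongrHom.injective.comp hinj₀
  have ht : ∀ (k : ℕ) (a b : Fin k → ℕ), Function.Injective a → Function.Injective b →
        ∃ g : G, ∀ i, ρ g (a i) = b i := by
    intro k a b ha hb
    obtain ⟨g, hg⟩ := ht₀ k (E.symm ∘ a) (E.symm ∘ b) (E.symm.injective.comp ha)
      (E.symm.injective.comp hb)
    refine ⟨g, fun i => ?_⟩
    have := hg i
    simp only [Function.comp_apply] at this
    rw [hρ, this, E.apply_symm_apply]
  have hexcl : ∀ N : Subgroup G, N.Normal → Nonempty (N ≃* AltN) → ¬ IsMIF G :=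
    fun N hN ⟨φ⟩ => HTD.not_mif N hN φ
  by_cases hinf : ∀ g : G, g ≠ 1 → {a | ρ g a ≠ a}.Infinite
  · have hM := HTD.mif_of_infinite_support ρ hinf ht
    exact Or.inr ⟨hM, fun ⟨N, hN, hφ⟩ => hexcl N hN hφ hM⟩
  · push Not at hinf
    obtain ⟨g, hg, hfin⟩ := hinf
    obtain ⟨N, hN, hφ⟩ := HTD.alt_of_finite_support ρ hinj ht g hg hfin
    exact Or.inl ⟨⟨N, hN, hφ⟩, hexcl N hN hφ⟩
end

section
/- If A and B are both nontrivial groups, then the direct product A × B is not MIF; consequently, a MIF group is not decomposable as a direct product of two nontrivial groups. -/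
/-- The direct product of two nontrivial groups is not MIF; hence a MIF group is directly
indecomposable. -/
theorem not_mif_prod (A B : Type*) [Group A] [Group B] [Nontrivial A] [Nontrivial B] :
    ¬ IsMIF (A × B) := by
  classical
  intro h
  obtain ⟨a, ha⟩ := exists_ne (1 : A)
  obtain ⟨b, hb⟩ := exists_ne (1 : B)
  -- the mixed identity `[a, x b x⁻¹] = 1`
  let α : Monoid.Coprod (A × B) (FreeGroup (Fin 1)) := Monoid.Coprod.inl (a, 1)
  let β : Monoid.Coprod (A × B) (FreeGroup (Fin 1)) := Monoid.Coprod.inl (1, b)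
  let x : Monoid.Coprod (A × B) (FreeGroup (Fin 1)) := Monoid.Coprod.inr (FreeGroup.of 0)
  have h1 : α * (x * β * x⁻¹) * α⁻¹ * (x * β * x⁻¹)⁻¹ = 1 := by
    apply h 1
    intro g
    simp only [α, β, x, map_mul, map_inv, Monoid.Coprod.lift_apply_inl,
      Monoid.Coprod.lift_apply_inr, FreeGroup.lift_apply_of, MonoidHom.id_apply]
    ext <;> simp
  have h2 : α * (x * β * x⁻¹) = (x * β * x⁻¹) * α := by
    rw [mul_inv_eq_one, mul_inv_eq_iff_eq_mul] at h1
    exact h1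
  -- let `A × B` act on `Option (A × B)` by left translation, and `x` swap `none` and `1`
  let σ : Equiv.Perm (Option (A × B)) := Equiv.swap none (some 1)
  let f : Monoid.Coprod (A × B) (FreeGroup (Fin 1)) →* Equiv.Perm (Option (A × B)) :=
    Monoid.Coprod.lift (MulAction.toPermHom (A × B) (Option (A × B)))
      (FreeGroup.lift fun _ => σ)
  have h3 := congrArg (fun y => f y none) h2
  have hb' : ((1, b) : A × B) ≠ 1 := by simp [Prod.ext_iff, hb]
  have hs : σ (some (1, b)) = some (1, b) :=
    Equiv.swap_apply_of_ne_of_ne (by simp) (by simpa using hb')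
  have hα : ∀ y, f α y = ((a, 1) : A × B) • y := fun y => rfl
  have hβ : ∀ y, f β y = ((1, b) : A × B) • y := fun y => rfl
  have hx : f x = σ := by simp [f, x]
  have hn : σ⁻¹ none = some 1 := by simp [σ]
  have e : ∀ c : A × B, c • (none : Option (A × B)) = none := fun c => rfl
  have e' : ∀ c d : A × B, c • (some d : Option (A × B)) = some (c * d) := fun c d => rfl
  simp only [map_mul, map_inv, Equiv.Perm.mul_apply, hα, hβ, hx, hn, e, e', mul_one, hs] at h3
  simp [ha] at h3
end
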